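/- For all reals v_0, v_1 with v_1 > 0 and 1/2 < v_0/v_1 < 1, the number of pure local strategy profiles (f_0,…,f_4), f_i : {0,1} → {0,1}, that are Nash equilibria of the game NC_00(C_5) with the uniform type distribution is exactly 40. -/

import Mathlib

open Finset

/-- The 6 questions/types of the game on the 5-cycle: `none` is `Tₐ = 11111`;
`some i` is the question `Tᵢ` giving input bit 1 to player `i` and 0 to the others. -/
abbrev C5Type := Option (ZMod 5)

/-- Input (type) bit of player `j` in question `t` of `MCG(C₅)`/`NC₀₀(C₅)`. -/
def inputBit : C5Type → ZMod 5 → ZMod 2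
  | none, _ => 1
  | some i, j => if j = i then 1 else 0

/-- The involved set of question `t`: all five players for `Tₐ`;
`{i-1, i, i+1}` for `Tᵢ`. -/
def involvedSet : C5Type → Finset (ZMod 5)
  | none => Finset.univ
  | some i => {i - 1, i, i + 1}

/-- The target parity bit of question `t`: `1` for `Tₐ` and `0` for each `Tᵢ`. -/
def targetBit : C5Type → ZMod 2
  | none => 1
  | some _ => 0

/-- Payoff of player `j` on (answer profile `s`, type `t`) in `NC₀₀(C₅)`:
`v_{s j}` if `s` wins on `t`, else `0`. -/
noncomputable def payoffOf (v0 v1 : ℝ) (j : ZMod 5) (s : ZMod 5 → ZMod 2)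
    (t : C5Type) : ℝ :=
  if ∑ k ∈ involvedSet t, s k = targetBit t then (if s j = 1 then v1 else v0) else 0

/-- Expected payoff of player `j` under the pure local strategy profile `f`
(player `i` answers `f i b` on type bit `b`), with the type uniform on the 6 types. -/
noncomputable def pureUtil (v0 v1 : ℝ) (f : ZMod 5 → ZMod 2 → ZMod 2) (j : ZMod 5) : ℝ :=
  (∑ t : C5Type, payoffOf v0 v1 j (fun i => f i (inputBit t i)) t) / 6

/-- The pure local strategy profile `f` is a Nash equilibrium of `NC₀₀(C₅)` with
the uniform type distribution: no player can strictly increase their expected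
payoff by unilaterally replacing their local function. -/
def IsNashEq (v0 v1 : ℝ) (f : ZMod 5 → ZMod 2 → ZMod 2) : Prop :=
  ∀ (i : ZMod 5) (g : ZMod 2 → ZMod 2),
    pureUtil v0 v1 (Function.update f i g) i ≤ pureUtil v0 v1 f i

/-- The number of questions won by `f` on which player `j` answers `a`. -/
def winCount (f : ZMod 5 → ZMod 2 → ZMod 2) (j : ZMod 5) (a : ZMod 2) : ℕ :=
  #{t : C5Type | ∑ k ∈ involvedSet t, f k (inputBit t k) = targetBit t ∧ f j (inputBit t j) = a}

lemma pureUtil_eq_winCount (v0 v1 : ℝ) (f : ZMod 5 → ZMod 2 → ZMod 2) (j : ZMod 5) :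
    pureUtil v0 v1 f j = (winCount f j 0 * v0 + winCount f j 1 * v1) / 6 := by
  have hzero (x : ZMod 2) : x = 0 ↔ ¬x = 1 := by revert x; decide
  simp only [pureUtil, payoffOf, winCount, card_filter, Nat.cast_sum, sum_mul, ← sum_add_distrib,
    hzero]
  congr 1
  refine sum_congr rfl fun t _ => ?_
  split_ifs <;> simp_all

/-- With payoffs `p + q` and `p + 2 * q` for the answers `0` and `1`, player `j`'s total payoff
under `f` is `(weights f j).1 * p + (weights f j).2 * q`. -/
def weights (f : ZMod 5 → ZMod 2 → ZMod 2) (j : ZMod 5) : ℕ × ℕ :=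
  (winCount f j 0 + winCount f j 1, winCount f j 0 + 2 * winCount f j 1)

lemma pureUtil_eq_weights (v0 v1 : ℝ) (f : ZMod 5 → ZMod 2 → ZMod 2) (j : ZMod 5) :
    pureUtil v0 v1 f j =
      ((weights f j).1 * (2 * v0 - v1) + (weights f j).2 * (v1 - v0)) / 6 := by
  rw [pureUtil_eq_winCount]
  simp only [weights]
  push_cast
  ring

/-- The profile whose answer `f i b` is the binary digit of `n` at position `2 * i + b`. -/
def profileOfDigits (n : Fin 1024) : ZMod 5 → ZMod 2 → ZMod 2 :=
  fun i b => if n.val.testBit (2 * i.val + b.val) then 1 else 0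

lemma profileOfDigits_bijective : Function.Bijective profileOfDigits := by
  refine (Fintype.bijective_iff_injective_and_card _).2 ⟨fun m n h => ?_, by simp [ZMod.card]⟩
  have key (i : ZMod 5) (b : ZMod 2) :
      m.val.testBit (2 * i.val + b.val) = n.val.testBit (2 * i.val + b.val) := by
    have := congrFun (congrFun h i) b
    simp only [profileOfDigits] at this
    split_ifs at this <;> simp_all
  refine Fin.ext (Nat.eq_of_testBit_eq fun k => ?_)
  by_cases hk : k < 10
  · interval_cases k
    exacts [key 0 0, key 0 1, key 1 0, key 1 1, key 2 0, key 2 1, key 3 0, key 3 1, key 4 0,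
      key 4 1]
  · have hpow : 1024 ≤ 2 ^ k := Nat.pow_le_pow_right (n := 2) (by norm_num) (not_lt.1 hk)
    rw [Nat.testBit_lt_two_pow (m.isLt.trans_le hpow), Nat.testBit_lt_two_pow (n.isLt.trans_le hpow)]

/-- Changing both digits of player `i` in `n` according to the two digits of `d`. -/
def flipDigits (n : Fin 1024) (i : ZMod 5) (d : Fin 4) : Fin 1024 :=
  ⟨n.val ^^^ d.val <<< (2 * i.val), by
    refine Nat.xor_lt_two_pow (n := 10) n.isLt ?_
    rw [Nat.shiftLeft_eq]
    calc d.val * 2 ^ (2 * i.val) < 4 * 2 ^ (2 * i.val) := by gcongr; exact d.isLt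
      _ ≤ 4 * 2 ^ (2 * 4) := by
        gcongr
        · norm_num
        · exact Nat.le_of_lt_succ (ZMod.val_lt i)
      _ = 2 ^ 10 := by norm_num⟩

lemma profileOfDigits_flipDigits (n : Fin 1024) (i : ZMod 5) (d : Fin 4) :
    profileOfDigits (flipDigits n i d) = Function.update (profileOfDigits n) i
      fun b => if n.val.testBit (2 * i.val + b.val) ^^ d.val.testBit b.val then 1 else 0 := by
  funext j b
  have hb : b.val < 2 := ZMod.val_lt b
  simp only [profileOfDigits, flipDigits, Nat.testBit_xor, Nat.testBit_shiftLeft]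
  rcases eq_or_ne j i with rfl | hne
  · simp
  · have hval : j.val ≠ i.val := fun h => hne (ZMod.val_injective 5 h)
    rw [Function.update_of_ne hne, profileOfDigits]
    rcases lt_or_gt_of_ne hval with hlt | hgt
    · simp [show ¬2 * i.val ≤ 2 * j.val + b.val by lia]
    · rw [Nat.testBit_lt_two_pow (x := d.val)]
      · simp
      · exact d.isLt.trans_le (Nat.pow_le_pow_right (n := 2) (i := 2) (by norm_num) (by lia))

lemma exists_profileOfDigits_flipDigits_eq (n : Fin 1024) (i : ZMod 5) (g : ZMod 2 → ZMod 2) :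
    ∃ d, profileOfDigits (flipDigits n i d) = Function.update (profileOfDigits n) i g := by
  have key : ∀ (x : ZMod 2 → Bool) (g : ZMod 2 → ZMod 2), ∃ d : Fin 4, ∀ b,
      (if x b ^^ d.val.testBit b.val then 1 else 0) = g b := by
    decide
  obtain ⟨d, hd⟩ := key (fun b => n.val.testBit (2 * i.val + b.val)) g
  exact ⟨d, by rw [profileOfDigits_flipDigits, funext hd]⟩

/-- The binary digit of `n` at position `2 * i + b`. -/
def digit (n i b : ℕ) : ℕ := (n >>> (2 * i + b)) % 2

/-- `1` if the profile with digits `n` wins on `Tₐ`, else `0`. -/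
def winAll (n : ℕ) : ℕ :=
  (digit n 0 1 + digit n 1 1 + digit n 2 1 + digit n 3 1 + digit n 4 1) % 2

/-- `1` if the profile with digits `n` wins on `Tᵢ`, else `0`. -/
def winAt (n i : ℕ) : ℕ :=
  (1 + digit n ((i + 4) % 5) 0 + digit n i 1 + digit n ((i + 1) % 5) 0) % 2

/-- The number of questions won by the profile with digits `n`. -/
def winTotal (n : ℕ) : ℕ :=
  winAll n + winAt n 0 + winAt n 1 + winAt n 2 + winAt n 3 + winAt n 4

/-- The number of questions won by the profile with digits `n` on which player `j` answers `1`. -/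
def winOne (n j : ℕ) : ℕ :=
  (winAll n + winAt n j) * digit n j 1 + (winTotal n - (winAll n + winAt n j)) * digit n j 0

lemma weights_profileOfDigits (n : Fin 1024) (j : ZMod 5) :
    weights (profileOfDigits n) j = (winTotal n, winTotal n + winOne n j.val) := by
  revert n j
  decide +kernel

/-- No unilateral deviation increases either coordinate of the deviator's weights. -/
def IsStable (n : Fin 1024) : Prop :=
  ∀ (i : ZMod 5) (d : Fin 4), winTotal (flipDigits n i d) ≤ winTotal n ∧
    winTotal (flipDigits n i d) + winOne (flipDigits n i d) i.val ≤ winTotal n + winOne n i.val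

instance : DecidablePred IsStable := fun n => by unfold IsStable; infer_instance

lemma isStable_or_exists_weights_lt (n : Fin 1024) : IsStable n ∨
    ∃ (i : ZMod 5) (d : Fin 4),
      weights (profileOfDigits n) i < weights (profileOfDigits (flipDigits n i d)) i := by
  simp only [weights_profileOfDigits, Prod.mk_lt_mk]
  revert n
  decide +kernel

lemma card_isStable : #{n | IsStable n} = 40 := by
  decide +kernel

lemma isNashEq_profileOfDigits_iff {v0 v1 : ℝ} (h0 : v1 < 2 * v0) (h1 : v0 < v1) (n : Fin 1024) :
    IsNashEq v0 v1 (profileOfDigits n) ↔ IsStable n := by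
  have hp : 0 < 2 * v0 - v1 := by linarith
  have hq : 0 < v1 - v0 := by linarith
  refine ⟨fun h => (isStable_or_exists_weights_lt n).resolve_right ?_, fun h i g => ?_⟩
  · rintro ⟨i, d, hlt⟩
    have hle := h i fun b =>
      if n.val.testBit (2 * i.val + b.val) ^^ d.val.testBit b.val then 1 else 0
    rw [← profileOfDigits_flipDigits] at hle
    refine hle.not_gt ?_
    rw [pureUtil_eq_weights, pureUtil_eq_weights]
    gcongr ?_ / 6
    obtain ⟨ha, hb⟩ | ⟨ha, hb⟩ := Prod.lt_iff.1 hlt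
    · exact add_lt_add_of_lt_of_le (by gcongr) (by gcongr)
    · exact add_lt_add_of_le_of_lt (by gcongr) (by gcongr)
  · obtain ⟨d, hd⟩ := exists_profileOfDigits_flipDigits_eq n i g
    obtain ⟨ha, hb⟩ := h i d
    rw [← hd, pureUtil_eq_weights, pureUtil_eq_weights, weights_profileOfDigits,
      weights_profileOfDigits]
    dsimp only
    gcongr

/-- **`NC₀₀(C₅)` has exactly 40 pure Nash equilibria when `1/2 < v0/v1 < 1`.** -/
theorem card_nash_NC00_of_ratio_gt_half (v0 v1 : ℝ) (hv1 : 0 < v1)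
    (h12 : 1 / 2 < v0 / v1) (h1 : v0 / v1 < 1) :
    {f : ZMod 5 → ZMod 2 → ZMod 2 | IsNashEq v0 v1 f}.ncard = 40 := by
  rw [lt_div_iff₀ hv1] at h12
  rw [div_lt_one hv1] at h1
  rw [← Set.ncard_preimage_of_injective_subset_range profileOfDigits_bijective.injective
    (by simp [profileOfDigits_bijective.surjective.range_eq]), ← card_isStable,
    ← Set.ncard_coe_finset]
  congr 1
  ext n
  simp [isNashEq_profileOfDigits_iff (by linarith : v1 < 2 * v0) h1]
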